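/- arXiv:1309.5598 — 3 statements merged into one kernel-verified Lean document; each statement's English description precedes it below -/
import Mathlib

section
/- Dimension of a generalized concatenated quantum code (Theorem 1, parts 1 and 2): In the GCQC setup, the stabilizer S_𝒞 = S_I + φ₁(S_{A₁}) + ⋯ + φ_m(S_{A_m}) has 𝔽₂-dimension (n − k₁)N + Σ_{i=1}^m r_i(N − K_i). Consequently the GCQC is a stabilizer code of length 𝒩 = nN qubits encoding 𝒦 = nN − dim_{𝔽₂} S_𝒞 = Σ_{i=1}^m (k_i − k_{i+1}) K_i qubits. -/
open Finset

/-- Pauli operators (up to phase) on `n` qubits, as symplectic vectors. -/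
abbrev Pauli (n : ℕ) := Fin n → (ZMod 2) × (ZMod 2)

/-- The outer space `W = (𝔽₂^r × 𝔽₂^r)^N`. -/
abbrev Outer (r N : ℕ) := Fin N → (Fin r → ZMod 2) × (Fin r → ZMod 2)

/-- `N` blocks of `n` qubits each. -/
abbrev PauliB (n N : ℕ) := Fin N → Pauli n

/-- Elementary symplectic form on one qubit. -/
def B0 : LinearMap.BilinForm (ZMod 2) ((ZMod 2) × (ZMod 2)) :=
  LinearMap.mk₂ (ZMod 2) (fun u v => u.1 * v.2 + v.1 * u.2)
    (fun a b v => by simp; ring)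
    (fun c a v => by simp; ring)
    (fun a b v => by simp; ring)
    (fun c a v => by simp; ring)

/-- Sum of a bilinear form over `N` coordinates. -/
def sumForm {M : Type*} [AddCommGroup M] [Module (ZMod 2) M] (N : ℕ)
    (B : LinearMap.BilinForm (ZMod 2) M) :
    LinearMap.BilinForm (ZMod 2) (Fin N → M) :=
  LinearMap.mk₂ (ZMod 2) (fun u v => ∑ j, B (u j) (v j))
    (fun a b v => by simp [Finset.sum_add_distrib])
    (fun c a v => by simp [Finset.mul_sum])
    (fun a b v => by simp [Finset.sum_add_distrib])
    (fun c a v => by simp [Finset.mul_sum])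

/-- Symplectic form on `r`-qubit blocks written as pairs of binary `r`-vectors. -/
def pairForm (r : ℕ) : LinearMap.BilinForm (ZMod 2) ((Fin r → ZMod 2) × (Fin r → ZMod 2)) :=
  LinearMap.mk₂ (ZMod 2) (fun u v => ∑ ℓ, (u.1 ℓ * v.2 ℓ + v.1 ℓ * u.2 ℓ))
    (fun a b v => by rw [← Finset.sum_add_distrib]; refine Finset.sum_congr rfl fun ℓ _ => by simp; ring)
    (fun c a v => by rw [smul_eq_mul, Finset.mul_sum]; refine Finset.sum_congr rfl fun ℓ _ => by simp; ring)
    (fun a b v => by rw [← Finset.sum_add_distrib]; refine Finset.sum_congr rfl fun ℓ _ => by simp; ring)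
    (fun c a v => by rw [smul_eq_mul, Finset.mul_sum]; refine Finset.sum_congr rfl fun ℓ _ => by simp; ring)

/-- Symplectic form on `Pauli n`. -/
def symplF (n : ℕ) : LinearMap.BilinForm (ZMod 2) (Pauli n) := sumForm n B0

/-- Symplectic form on `N` blocks of `n` qubits. -/
def symplFB (n N : ℕ) : LinearMap.BilinForm (ZMod 2) (PauliB n N) := sumForm N (symplF n)

/-- Symplectic form on the outer space `W_i`. -/
def symplFO (r N : ℕ) : LinearMap.BilinForm (ZMod 2) (Outer r N) := sumForm N (pairForm r)

/-- Orthogonal complement of a subspace w.r.t. a bilinear form. -/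
def perp {M : Type*} [AddCommGroup M] [Module (ZMod 2) M]
    (B : LinearMap.BilinForm (ZMod 2) M) (S : Submodule (ZMod 2) M) :
    Submodule (ZMod 2) M where
  carrier := {v | ∀ s ∈ S, B s v = 0}
  add_mem' := fun hu hv s hs => by
    rw [map_add, hu s hs, hv s hs, add_zero]
  zero_mem' := fun s hs => by simp
  smul_mem' := fun c v hv s hs => by
    rw [map_smul, hv s hs, smul_zero]

/-- Generic weight: number of nonzero coordinates. -/
def wgt {N : ℕ} {M : Type*} [Zero M] [DecidableEq M] (v : Fin N → M) : ℕ :=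
  (Finset.univ.filter fun j => v j ≠ 0).card

/-- Symplectic weight on `N` blocks of `n` qubits: number of nonzero qubit positions. -/
def swtB {n N : ℕ} (v : PauliB n N) : ℕ := ∑ j, wgt (v j)

/-- Stabilizer of the subcode `B_i`: `S` together with the logical `z`'s of index `< kk`. -/
def Sstab (n : ℕ) (S : Submodule (ZMod 2) (Pauli n)) (z : ℕ → Pauli n) (kk : ℕ) :
    Submodule (ZMod 2) (Pauli n) :=
  S ⊔ Submodule.span (ZMod 2) (z '' Set.Iio kk)

/-- Span of the logical operators `x_t, z_t` with `a ≤ t < b` (0-based indexing). -/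
def Lspan (n : ℕ) (x z : ℕ → Pauli n) (a b : ℕ) : Submodule (ZMod 2) (Pauli n) :=
  Submodule.span (ZMod 2) ((x '' Set.Ico a b) ∪ (z '' Set.Ico a b))

/-- The block-wise inner stabilizer `S_I`. -/
def SI (n N : ℕ) (S : Submodule (ZMod 2) (Pauli n)) : Submodule (ZMod 2) (PauliB n N) :=
  Submodule.pi (Set.univ : Set (Fin N)) (fun _ => S)

/-- The replacement map `φ` with offset `off`, sending the `ℓ`-th binary coordinates of each
block to the logical operators `x (off+ℓ)`, `z (off+ℓ)` of the inner code. -/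
def phi (n N : ℕ) (x z : ℕ → Pauli n) (off r : ℕ) :
    Outer r N →ₗ[ZMod 2] PauliB n N where
  toFun w := fun j =>
    (∑ ℓ : Fin r, (w j).1 ℓ • x (off + ℓ)) + (∑ ℓ : Fin r, (w j).2 ℓ • z (off + ℓ))
  map_add' := fun a b => by
    funext j
    simp [add_smul, Finset.sum_add_distrib]
    abel
  map_smul' := fun c a => by
    funext j
    simp [mul_smul, Finset.smul_sum, smul_add]

theorem Submodule.finrank_pi_const {ι K V : Type*} [Fintype ι] [DivisionRing K] [AddCommGroup V]
    [Module K V] [FiniteDimensional K V] (S : Submodule K V) :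
    Module.finrank K (Submodule.pi (Set.univ : Set ι) fun _ => S)
      = Fintype.card ι * Module.finrank K S := by
  have hinj : Function.Injective (LinearMap.piMap fun _ : ι => S.subtype) := fun a b h => by
    funext i
    exact Subtype.ext (congrFun h i)
  have hrange : LinearMap.range (LinearMap.piMap fun _ : ι => S.subtype)
      = Submodule.pi Set.univ fun _ => S := by
    ext v
    constructor
    · rintro ⟨a, rfl⟩ i -
      exact (a i).2
    · intro hv
      exact ⟨fun i => ⟨v i, hv i trivial⟩, rfl⟩
  rw [← hrange, LinearMap.finrank_range_of_inj hinj, Module.finrank_pi_fintype]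
  simp

/-- If every `P i` is separated from `S₀` and from the other `P j` by a linear map that is
injective on `P i` and kills the rest, then dimensions add up. -/
theorem Submodule.finrank_sup_biSup_of_separating {ι K V : Type*} [DivisionRing K]
    [AddCommGroup V] [Module K V] [FiniteDimensional K V] {W : ι → Type*}
    [∀ i, AddCommGroup (W i)] [∀ i, Module K (W i)] (S₀ : Submodule K V) (P : ι → Submodule K V)
    (ψ : ∀ i, V →ₗ[K] W i) (s : Finset ι)
    (hS₀ : ∀ i ∈ s, S₀ ≤ LinearMap.ker (ψ i))
    (hne : ∀ i ∈ s, ∀ j ∈ s, j ≠ i → P j ≤ LinearMap.ker (ψ i))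
    (hP : ∀ i ∈ s, Disjoint (P i) (LinearMap.ker (ψ i))) :
    Module.finrank K ↥(S₀ ⊔ ⨆ i ∈ s, P i)
      = Module.finrank K S₀ + ∑ i ∈ s, Module.finrank K (P i) := by
  classical
  induction s using Finset.induction_on with
  | empty => rw [show ⨆ i ∈ (∅ : Finset ι), P i = ⊥ by simp, sup_bot_eq, Finset.sum_empty, add_zero]
  | insert a s ha ih =>
    have hdisj : Disjoint (P a) (S₀ ⊔ ⨆ i ∈ s, P i) := by
      refine (hP a (Finset.mem_insert_self a s)).mono_right
        (sup_le (hS₀ a (Finset.mem_insert_self a s)) (iSup₂_le fun j hj => ?_))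
      exact hne a (Finset.mem_insert_self a s) j (Finset.mem_insert_of_mem hj)
        (ne_of_mem_of_not_mem hj ha)
    have hdim := Submodule.finrank_sup_add_finrank_inf_eq (P a) (S₀ ⊔ ⨆ i ∈ s, P i)
    rw [hdisj.eq_bot, finrank_bot, add_zero,
      ih (fun i hi => hS₀ i (Finset.mem_insert_of_mem hi))
        (fun i hi j hj => hne i (Finset.mem_insert_of_mem hi) j (Finset.mem_insert_of_mem hj))
        (fun i hi => hP i (Finset.mem_insert_of_mem hi))] at hdim
    rw [Finset.iSup_insert, Finset.sum_insert ha, sup_left_comm, hdim]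
    ring

theorem symplF_comm (n : ℕ) (u v : Pauli n) : symplF n u v = symplF n v u := by
  simp only [symplF, sumForm, B0, LinearMap.mk₂_apply]
  exact Finset.sum_congr rfl fun _ _ => add_comm _ _

/-- The blockwise syndrome of `v` with respect to the logical operators `x t`, `z t`,
`off ≤ t < off + r`. -/
def logicalSyndrome (n N : ℕ) (x z : ℕ → Pauli n) (off r : ℕ) :
    PauliB n N →ₗ[ZMod 2] Outer r N where
  toFun v := fun j =>
    (fun ℓ => symplF n (v j) (z (off + ℓ)), fun ℓ => symplF n (v j) (x (off + ℓ)))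
  map_add' := fun a b => by
    funext j
    ext <;> simp
  map_smul' := fun c a => by
    funext j
    ext <;> simp

section Logical

variable {n N κ : ℕ} {x z : ℕ → Pauli n}

theorem logicalSyndrome_phi_self
    (hxx : ∀ s < κ, ∀ t < κ, symplF n (x s) (x t) = 0)
    (hzz : ∀ s < κ, ∀ t < κ, symplF n (z s) (z t) = 0)
    (hxz : ∀ s < κ, ∀ t < κ, symplF n (x s) (z t) = if s = t then 1 else 0)
    {off r : ℕ} (h : off + r ≤ κ) (w : Outer r N) :
    logicalSyndrome n N x z off r (phi n N x z off r w) = w := by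
  have hlt (ℓ : Fin r) : off + (ℓ : ℕ) < κ := by omega
  funext j
  ext ℓ
  · simp [logicalSyndrome, phi, hzz _ (hlt _) _ (hlt _), hxz _ (hlt _) _ (hlt _), Fin.val_inj]
  · simp [logicalSyndrome, phi, hxx _ (hlt _) _ (hlt _), symplF_comm n (z _) (x _),
      hxz _ (hlt _) _ (hlt _), Fin.val_inj]

theorem logicalSyndrome_phi_of_disjoint
    (hxx : ∀ s < κ, ∀ t < κ, symplF n (x s) (x t) = 0)
    (hzz : ∀ s < κ, ∀ t < κ, symplF n (z s) (z t) = 0)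
    (hxz : ∀ s < κ, ∀ t < κ, symplF n (x s) (z t) = if s = t then 1 else 0)
    {off r off' r' : ℕ} (h : off + r ≤ κ) (h' : off' + r' ≤ κ)
    (hdisj : off + r ≤ off' ∨ off' + r' ≤ off) (w : Outer r' N) :
    logicalSyndrome n N x z off r (phi n N x z off' r' w) = 0 := by
  have hlt (ℓ : Fin r) : off + (ℓ : ℕ) < κ := by omega
  have hlt' (ℓ : Fin r') : off' + (ℓ : ℕ) < κ := by omega
  have hne (a : Fin r') (b : Fin r) : off' + (a : ℕ) ≠ off + b := by omega
  funext j
  ext ℓ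
  · simp [logicalSyndrome, phi, hzz _ (hlt' _) _ (hlt _), hxz _ (hlt' _) _ (hlt _), hne]
  · simp [logicalSyndrome, phi, hxx _ (hlt' _) _ (hlt _), symplF_comm n (z _) (x _),
      hxz _ (hlt _) _ (hlt' _), (hne _ _).symm]

theorem SI_le_ker_logicalSyndrome {S : Submodule (ZMod 2) (Pauli n)}
    (hxS : ∀ t < κ, x t ∈ perp (symplF n) S) (hzS : ∀ t < κ, z t ∈ perp (symplF n) S)
    {off r : ℕ} (h : off + r ≤ κ) :
    SI n N S ≤ LinearMap.ker (logicalSyndrome n N x z off r) := by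
  intro v hv
  have hlt (ℓ : Fin r) : off + (ℓ : ℕ) < κ := by omega
  rw [LinearMap.mem_ker]
  funext j
  ext ℓ
  · exact hzS _ (hlt ℓ) _ (hv j trivial)
  · exact hxS _ (hlt ℓ) _ (hv j trivial)

end Logical

/-- Theorem 1, parts 1 and 2: length and dimension of a GCQC. -/
theorem gcqc_dimension
    (n N m : ℕ) (hm : 1 ≤ m)
    (k : ℕ → ℕ) (hk : ∀ i, 1 ≤ i → i ≤ m → k (i + 1) < k i) (hklast : k (m + 1) = 0)
    (hkn : k 1 ≤ n)
    (S : Submodule (ZMod 2) (Pauli n))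
    (hSorth : S ≤ perp (symplF n) S)
    (hSdim : Module.finrank (ZMod 2) S = n - k 1)
    (x z : ℕ → Pauli n)
    (hxS : ∀ t < k 1, x t ∈ perp (symplF n) S)
    (hzS : ∀ t < k 1, z t ∈ perp (symplF n) S)
    (hxx : ∀ s < k 1, ∀ t < k 1, symplF n (x s) (x t) = 0)
    (hzz : ∀ s < k 1, ∀ t < k 1, symplF n (z s) (z t) = 0)
    (hxz : ∀ s < k 1, ∀ t < k 1, symplF n (x s) (z t) = if s = t then 1 else 0)
    (hdual : perp (symplF n) S = S ⊔ Lspan n x z 0 (k 1))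
    (hdisj : Disjoint S (Lspan n x z 0 (k 1)))
    (d : ℕ → ℕ)
    (hd : ∀ i, 1 ≤ i → i ≤ m + 1 → ∀ v ∈ perp (symplF n) (Sstab n S z (k 1 - k i)),
      v ∉ Sstab n S z (k 1 - k i) → d i ≤ wgt v)
    (K D : ℕ → ℕ) (hKN : ∀ i, 1 ≤ i → i ≤ m → K i ≤ N)
    (SA : ∀ i : ℕ, Submodule (ZMod 2) (Outer (k i - k (i + 1)) N))
    (hSAorth : ∀ i, 1 ≤ i → i ≤ m → SA i ≤ perp (symplFO (k i - k (i + 1)) N) (SA i))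
    (hSAdim : ∀ i, 1 ≤ i → i ≤ m →
      Module.finrank (ZMod 2) (SA i) = (k i - k (i + 1)) * (N - K i))
    (hSAdist : ∀ i, 1 ≤ i → i ≤ m → ∀ w ∈ perp (symplFO (k i - k (i + 1)) N) (SA i),
      w ∉ SA i → D i ≤ wgt w)
    (SC : Submodule (ZMod 2) (PauliB n N))
    (hSC : SC = SI n N S ⊔ ⨆ i ∈ Finset.Icc 1 m,
      Submodule.map (phi n N x z (k 1 - k i) (k i - k (i + 1))) (SA i)) :
    Module.finrank (ZMod 2) SC
        = (n - k 1) * N + ∑ i ∈ Finset.Icc 1 m, (k i - k (i + 1)) * (N - K i)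
      ∧ n * N - Module.finrank (ZMod 2) SC
        = ∑ i ∈ Finset.Icc 1 m, (k i - k (i + 1)) * K i := by
  have hanti : AntitoneOn k (Set.Icc 1 (m + 1)) :=
    antitoneOn_of_succ_le Set.ordConnected_Icc fun i _ hi hi' =>
      (hk i hi.1 (by simpa using hi'.2)).le
  have hoff : ∀ i ∈ Finset.Icc 1 m, k (i + 1) ≤ k i ∧ k i ≤ k 1 := fun i hi => by
    obtain ⟨h1, h2⟩ := Finset.mem_Icc.1 hi
    exact ⟨(hk i h1 h2).le, hanti ⟨le_rfl, by omega⟩ ⟨h1, by omega⟩ h1⟩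
  have hbound : ∀ i ∈ Finset.Icc 1 m, k 1 - k i + (k i - k (i + 1)) ≤ k 1 := fun i hi => by
    have := hoff i hi
    omega
  have hself : ∀ i ∈ Finset.Icc 1 m, ∀ w : Outer (k i - k (i + 1)) N, _ := fun i hi =>
    logicalSyndrome_phi_self hxx hzz hxz (hbound i hi)
  have hdim : Module.finrank (ZMod 2) SC
      = (n - k 1) * N + ∑ i ∈ Finset.Icc 1 m, (k i - k (i + 1)) * (N - K i) := by
    rw [hSC, Submodule.finrank_sup_biSup_of_separating _ _
      (fun i => logicalSyndrome n N x z (k 1 - k i) (k i - k (i + 1))) _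
      (fun i hi => SI_le_ker_logicalSyndrome hxS hzS (hbound i hi)) ?_ ?_]
    · congr 1
      · rw [SI, Submodule.finrank_pi_const, Fintype.card_fin, hSdim, mul_comm]
      · refine Finset.sum_congr rfl fun i hi => ?_
        rw [← hSAdim i (Finset.mem_Icc.1 hi).1 (Finset.mem_Icc.1 hi).2]
        exact (Submodule.equivMapOfInjective _
          (Function.LeftInverse.injective (hself i hi)) (SA i)).finrank_eq.symm
    · rintro i hi j hj hji _ ⟨w, -, rfl⟩
      refine logicalSyndrome_phi_of_disjoint hxx hzz hxz (hbound i hi) (hbound j hj) ?_ w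
      have := hoff i hi
      have := hoff j hj
      rw [Finset.mem_Icc] at hi hj
      rcases lt_or_gt_of_ne hji with h | h
      · have := hanti (a := j + 1) (b := i) ⟨by omega, by omega⟩ ⟨by omega, by omega⟩ h
        omega
      · have := hanti (a := i + 1) (b := j) ⟨by omega, by omega⟩ ⟨by omega, by omega⟩ h
        omega
    · intro i hi
      rw [Submodule.disjoint_def]
      rintro _ ⟨w, -, rfl⟩ hw
      rw [LinearMap.mem_ker, hself i hi] at hw
      rw [hw, map_zero]
  refine ⟨hdim, ?_⟩
  have htel : ∑ i ∈ Finset.Icc 1 m, (k i - k (i + 1)) = k 1 := by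
    zify
    rw [Finset.sum_congr rfl fun i hi => Nat.cast_sub (hoff i hi).1,
      ← Finset.Ico_add_one_right_eq_Icc, ← neg_inj, ← Finset.sum_neg_distrib]
    simp only [neg_sub]
    rw [Finset.sum_Ico_sub (fun i => (k i : ℤ)) (by omega), hklast]
    simp
  have hsplit : ∑ i ∈ Finset.Icc 1 m, (k i - k (i + 1)) * (N - K i)
      + ∑ i ∈ Finset.Icc 1 m, (k i - k (i + 1)) * K i = k 1 * N := by
    rw [← Finset.sum_add_distrib, ← htel, Finset.sum_mul]
    refine Finset.sum_congr rfl fun i hi => ?_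
    rw [← mul_add, Nat.sub_add_cancel (hKN i (Finset.mem_Icc.1 hi).1 (Finset.mem_Icc.1 hi).2)]
  have htotal : n * N = (n - k 1) * N + k 1 * N := by
    rw [← add_mul, Nat.sub_add_cancel hkn]
  omega
end

section
/- Distance bound without nondegeneracy assumptions (Eq. (19)): In the GCQC setup, every element of S_𝒞^⊥ ∖ S_𝒞 has symplectic weight at least d₁ · min_{1 ≤ i ≤ m} D_i; i.e., the minimum distance of the GCQC satisfies 𝒟 ≥ d₁ · min_{1 ≤ i ≤ m} D_i, even when the first outer code is degenerate. -/
open Finset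

theorem sumForm_apply {M : Type*} [AddCommGroup M] [Module (ZMod 2) M] (N : ℕ)
    (B : LinearMap.BilinForm (ZMod 2) M) (u v : Fin N → M) :
    sumForm N B u v = ∑ j, B (u j) (v j) := rfl

theorem sumForm_comm {M : Type*} [AddCommGroup M] [Module (ZMod 2) M] (N : ℕ)
    (B : LinearMap.BilinForm (ZMod 2) M) (hB : ∀ u v, B u v = B v u) (u v : Fin N → M) :
    sumForm N B u v = sumForm N B v u := by
  simp only [sumForm_apply]
  exact Finset.sum_congr rfl fun j _ => hB _ _

theorem Sstab_zero (n : ℕ) (S : Submodule (ZMod 2) (Pauli n)) (z : ℕ → Pauli n) :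
    Sstab n S z 0 = S := by
  simp [Sstab]

/-- The component of `v` along the first `q` logical operators, read off from syndromes. -/
def logicalPart (n : ℕ) (x z : ℕ → Pauli n) (q : ℕ) : Pauli n →ₗ[ZMod 2] Pauli n :=
  ∑ t ∈ Finset.range q,
    ((symplF n (z t)).smulRight (x t) + (symplF n (x t)).smulRight (z t))

theorem logicalPart_apply (n : ℕ) (x z : ℕ → Pauli n) (q : ℕ) (v : Pauli n) :
    logicalPart n x z q v =
      ∑ t ∈ Finset.range q, (symplF n (z t) v • x t + symplF n (x t) v • z t) := by
  simp [logicalPart, LinearMap.sum_apply]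

theorem logicalPart_eq_zero {n q : ℕ} {S : Submodule (ZMod 2) (Pauli n)} {x z : ℕ → Pauli n}
    (hxS : ∀ t < q, x t ∈ perp (symplF n) S) (hzS : ∀ t < q, z t ∈ perp (symplF n) S)
    {v : Pauli n} (hv : v ∈ S) : logicalPart n x z q v = 0 := by
  rw [logicalPart_apply]
  refine Finset.sum_eq_zero fun t ht => ?_
  have ht := Finset.mem_range.1 ht
  rw [symplF_comm n (z t), symplF_comm n (x t), hxS t ht v hv, hzS t ht v hv]
  simp

theorem logicalPart_eq_self {n q : ℕ} {x z : ℕ → Pauli n}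
    (hxx : ∀ s < q, ∀ t < q, symplF n (x s) (x t) = 0)
    (hzz : ∀ s < q, ∀ t < q, symplF n (z s) (z t) = 0)
    (hxz : ∀ s < q, ∀ t < q, symplF n (x s) (z t) = if s = t then 1 else 0)
    {v : Pauli n} (hv : v ∈ Lspan n x z 0 q) : logicalPart n x z q v = v := by
  have key : Lspan n x z 0 q ≤ LinearMap.eqLocus (logicalPart n x z q) LinearMap.id := by
    refine Submodule.span_le.2 ?_
    rintro _ (⟨s, hs, rfl⟩ | ⟨s, hs, rfl⟩)
    · have hs : s < q := hs.2
      change logicalPart n x z q (x s) = x s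
      rw [logicalPart_apply, Finset.sum_eq_single_of_mem s (Finset.mem_range.2 hs)]
      · rw [symplF_comm n (z s), hxz s hs s hs, hxx s hs s hs]
        simp
      · intro t ht hts
        have ht := Finset.mem_range.1 ht
        rw [symplF_comm n (z t), hxz s hs t ht, hxx t ht s hs, if_neg (Ne.symm hts)]
        simp
    · have hs : s < q := hs.2
      change logicalPart n x z q (z s) = z s
      rw [logicalPart_apply, Finset.sum_eq_single_of_mem s (Finset.mem_range.2 hs)]
      · rw [hxz s hs s hs, hzz s hs s hs]
        simp
      · intro t ht hts
        have ht := Finset.mem_range.1 ht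
        rw [hxz t ht s hs, hzz t ht s hs, if_neg hts]
        simp
  exact key hv

theorem sub_logicalPart_mem {n q : ℕ} {S : Submodule (ZMod 2) (Pauli n)} {x z : ℕ → Pauli n}
    (hxS : ∀ t < q, x t ∈ perp (symplF n) S) (hzS : ∀ t < q, z t ∈ perp (symplF n) S)
    (hxx : ∀ s < q, ∀ t < q, symplF n (x s) (x t) = 0)
    (hzz : ∀ s < q, ∀ t < q, symplF n (z s) (z t) = 0)
    (hxz : ∀ s < q, ∀ t < q, symplF n (x s) (z t) = if s = t then 1 else 0)
    {v : Pauli n} (hv : v ∈ S ⊔ Lspan n x z 0 q) : v - logicalPart n x z q v ∈ S := by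
  obtain ⟨s, hs, l, hl, rfl⟩ := Submodule.mem_sup.1 hv
  rw [map_add, logicalPart_eq_zero hxS hzS hs, logicalPart_eq_self hxx hzz hxz hl]
  simpa using hs

/-- The syndromes of each block of `v` against the logical operators with indices in
`[off, off + r)`, arranged as a vector of the outer space. -/
def outerPart (n N : ℕ) (x z : ℕ → Pauli n) (off r : ℕ) (v : PauliB n N) : Outer r N :=
  fun j => (fun ℓ => symplF n (z (off + ℓ)) (v j), fun ℓ => symplF n (x (off + ℓ)) (v j))

theorem phi_outerPart_apply (n N : ℕ) (x z : ℕ → Pauli n) (off r : ℕ) (v : PauliB n N)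
    (j : Fin N) :
    phi n N x z off r (outerPart n N x z off r v) j =
      ∑ l ∈ Finset.range r, (symplF n (z (off + l)) (v j) • x (off + l) +
        symplF n (x (off + l)) (v j) • z (off + l)) := by
  rw [Finset.sum_range, Finset.sum_add_distrib]
  rfl

theorem symplFO_outerPart (n N : ℕ) (x z : ℕ → Pauli n) (off r : ℕ) (w : Outer r N)
    (v : PauliB n N) :
    symplFO r N w (outerPart n N x z off r v) = symplFB n N (phi n N x z off r w) v := by
  rw [symplFO, symplFB, sumForm_apply, sumForm_apply]
  refine Finset.sum_congr rfl fun j _ => ?_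
  change ∑ l : Fin r, ((w j).1 l * symplF n (x (off + l)) (v j) +
      symplF n (z (off + l)) (v j) * (w j).2 l) =
    symplF n ((∑ l : Fin r, (w j).1 l • x (off + l)) + ∑ l : Fin r, (w j).2 l • z (off + l)) (v j)
  simp [Finset.sum_add_distrib, LinearMap.sum_apply, mul_comm]

theorem outerPart_apply_eq_zero {n N off r : ℕ} {S : Submodule (ZMod 2) (Pauli n)}
    {x z : ℕ → Pauli n}
    (hxS : ∀ l < r, x (off + l) ∈ perp (symplF n) S)
    (hzS : ∀ l < r, z (off + l) ∈ perp (symplF n) S)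
    {v : PauliB n N} {j : Fin N} (hv : v j ∈ S) : outerPart n N x z off r v j = 0 := by
  refine Prod.ext (funext fun l => ?_) (funext fun l => ?_)
  · exact (symplF_comm n _ _).trans (hzS l l.2 _ hv)
  · exact (symplF_comm n _ _).trans (hxS l l.2 _ hv)

/-- A decreasing sequence `k` cuts `[0, k 1 - k (m + 1))` into consecutive intervals. -/
theorem sum_range_eq_sum_layers {M : Type*} [AddCommMonoid M] (k : ℕ → ℕ) (f : ℕ → M) (m : ℕ)
    (hk : ∀ i, 1 ≤ i → i ≤ m → k (i + 1) ≤ k i) :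
    k (m + 1) ≤ k 1 ∧ ∑ t ∈ Finset.range (k 1 - k (m + 1)), f t =
      ∑ i ∈ Finset.Icc 1 m, ∑ l ∈ Finset.range (k i - k (i + 1)), f (k 1 - k i + l) := by
  induction m with
  | zero => simp
  | succ m ih =>
    obtain ⟨hle, hsum⟩ := ih fun i h1 h2 => hk i h1 (h2.trans m.le_succ)
    have hstep := hk (m + 1) (by omega) le_rfl
    refine ⟨hstep.trans hle, ?_⟩
    rw [Finset.sum_Icc_succ_top (by omega), ← hsum, ← Finset.sum_range_add]
    congr 2
    omega

theorem apply_mem_perp_of_mem_perp {n N : ℕ} {S : Submodule (ZMod 2) (Pauli n)}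
    {v : PauliB n N} (hv : v ∈ perp (symplFB n N) (SI n N S)) (j : Fin N) :
    v j ∈ perp (symplF n) S := by
  intro s hs
  have hmem : Pi.single j s ∈ SI n N S := by
    intro i _
    by_cases hij : i = j
    · subst hij
      simpa using hs
    · simp [hij]
  have h := hv _ hmem
  rw [symplFB, sumForm_apply, Finset.sum_eq_single j] at h
  · simpa using h
  · intro i _ hij
    simp [hij]
  · simp

theorem mul_wgt_le_swtB {n N : ℕ} {M : Type*} [Zero M] [DecidableEq M] {w : Fin N → M}
    {v : PauliB n N} {δ : ℕ} (h : ∀ j, w j ≠ 0 → δ ≤ wgt (v j)) : δ * wgt w ≤ swtB v := by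
  calc δ * wgt w = ∑ j with w j ≠ 0, δ := by simp [wgt, mul_comm]
    _ ≤ ∑ j with w j ≠ 0, wgt (v j) :=
      Finset.sum_le_sum fun j hj => h j (Finset.mem_filter.1 hj).2
    _ ≤ swtB v := Finset.sum_le_sum_of_subset (Finset.filter_subset _ _)

/-- Eq. (19): distance bound without nondegeneracy assumptions:
`swtB v ≥ d_1 · min_{1 ≤ i ≤ m} D_i` for every `v ∈ S_𝒞^⊥ ∖ S_𝒞`. -/
theorem gcqc_distance_bound_degenerate
    (n N m : ℕ) (hm : 1 ≤ m)
    (k : ℕ → ℕ) (hk : ∀ i, 1 ≤ i → i ≤ m → k (i + 1) < k i) (hklast : k (m + 1) = 0)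
    (hkn : k 1 ≤ n)
    (S : Submodule (ZMod 2) (Pauli n))
    (hSorth : S ≤ perp (symplF n) S)
    (hSdim : Module.finrank (ZMod 2) S = n - k 1)
    (x z : ℕ → Pauli n)
    (hxS : ∀ t < k 1, x t ∈ perp (symplF n) S)
    (hzS : ∀ t < k 1, z t ∈ perp (symplF n) S)
    (hxx : ∀ s < k 1, ∀ t < k 1, symplF n (x s) (x t) = 0)
    (hzz : ∀ s < k 1, ∀ t < k 1, symplF n (z s) (z t) = 0)
    (hxz : ∀ s < k 1, ∀ t < k 1, symplF n (x s) (z t) = if s = t then 1 else 0)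
    (hdual : perp (symplF n) S = S ⊔ Lspan n x z 0 (k 1))
    (hdisj : Disjoint S (Lspan n x z 0 (k 1)))
    (d : ℕ → ℕ)
    (hd : ∀ i, 1 ≤ i → i ≤ m + 1 → ∀ v ∈ perp (symplF n) (Sstab n S z (k 1 - k i)),
      v ∉ Sstab n S z (k 1 - k i) → d i ≤ wgt v)
    (K D : ℕ → ℕ) (hKN : ∀ i, 1 ≤ i → i ≤ m → K i ≤ N)
    (SA : ∀ i : ℕ, Submodule (ZMod 2) (Outer (k i - k (i + 1)) N))
    (hSAorth : ∀ i, 1 ≤ i → i ≤ m → SA i ≤ perp (symplFO (k i - k (i + 1)) N) (SA i))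
    (hSAdim : ∀ i, 1 ≤ i → i ≤ m →
      Module.finrank (ZMod 2) (SA i) = (k i - k (i + 1)) * (N - K i))
    (hSAdist : ∀ i, 1 ≤ i → i ≤ m → ∀ w ∈ perp (symplFO (k i - k (i + 1)) N) (SA i),
      w ∉ SA i → D i ≤ wgt w)
    (SC : Submodule (ZMod 2) (PauliB n N))
    (hSC : SC = SI n N S ⊔ ⨆ i ∈ Finset.Icc 1 m,
      Submodule.map (phi n N x z (k 1 - k i) (k i - k (i + 1))) (SA i)) :
    ∀ v ∈ perp (symplFB n N) SC, v ∉ SC →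
      ∀ c : ℕ, (∀ i, 1 ≤ i → i ≤ m → c ≤ d 1 * D i) → c ≤ swtB v := by
  intro v hv hvSC c hc
  have hSI : SI n N S ≤ SC := hSC ▸ le_sup_left
  have hmap : ∀ i ∈ Finset.Icc 1 m,
      Submodule.map (phi n N x z (k 1 - k i) (k i - k (i + 1))) (SA i) ≤ SC := fun i hi =>
    hSC ▸ (le_iSup₂_of_le (f := fun i (_ : i ∈ Finset.Icc 1 m) =>
      Submodule.map (phi n N x z (k 1 - k i) (k i - k (i + 1))) (SA i)) i hi le_rfl).trans
      le_sup_right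
  have hvj : ∀ j, v j ∈ perp (symplF n) S :=
    apply_mem_perp_of_mem_perp fun s hs => hv s (hSI hs)
  set w : ∀ i, Outer (k i - k (i + 1)) N :=
    fun i => outerPart n N x z (k 1 - k i) (k i - k (i + 1)) v with hw
  have hwperp : ∀ i, 1 ≤ i → i ≤ m → w i ∈ perp (symplFO (k i - k (i + 1)) N) (SA i) := by
    intro i h1 h2 s hs
    rw [hw, symplFO_outerPart]
    exact hv _ (hmap i (Finset.mem_Icc.2 ⟨h1, h2⟩) (Submodule.mem_map_of_mem hs))
  obtain ⟨i, h1, h2, hi⟩ : ∃ i, 1 ≤ i ∧ i ≤ m ∧ w i ∉ SA i := by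
    by_contra! hall
    refine hvSC ?_
    have hsplit : v - ∑ i ∈ Finset.Icc 1 m,
        phi n N x z (k 1 - k i) (k i - k (i + 1)) (w i) ∈ SI n N S := by
      intro j _
      have hj := sub_logicalPart_mem hxS hzS hxx hzz hxz (hdual ▸ hvj j)
      have hsum := (sum_range_eq_sum_layers k
        (fun t => symplF n (z t) (v j) • x t + symplF n (x t) (v j) • z t) m
        fun i h1 h2 => (hk i h1 h2).le).2
      rw [hklast, Nat.sub_zero] at hsum
      rw [logicalPart_apply, hsum] at hj
      simpa only [SetLike.mem_coe, Pi.sub_apply, Finset.sum_apply, hw, phi_outerPart_apply] using hj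
    rw [← sub_add_cancel v (∑ i ∈ Finset.Icc 1 m,
      phi n N x z (k 1 - k i) (k i - k (i + 1)) (w i))]
    refine SC.add_mem (hSI hsplit) (SC.sum_mem fun i hi => hmap i hi ?_)
    have hi' := Finset.mem_Icc.1 hi
    exact Submodule.mem_map_of_mem (hall i hi'.1 hi'.2)
  have hki : k i ≤ k 1 := by
    obtain ⟨p, rfl⟩ := Nat.exists_eq_add_of_le' h1
    exact (sum_range_eq_sum_layers k (fun _ => 0) p
      fun i' h1' h2' => (hk i' h1' (by omega)).le).1
  refine (hc i h1 h2).trans ((Nat.mul_le_mul_left _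
    (hSAdist i h1 h2 (w i) (hwperp i h1 h2) hi)).trans (mul_wgt_le_swtB fun j hj => ?_))
  have hd1 := hd 1 le_rfl (by omega) (v j)
  rw [Nat.sub_self, Sstab_zero] at hd1
  refine hd1 (hvj j) fun hS => hj (outerPart_apply_eq_zero ?_ ?_ hS)
  · exact fun l hl => hxS _ (by omega)
  · exact fun l hl => hzS _ (by omega)
end

section
/- Example 2 (a degenerate outer code forces distance 1): Let S_𝒞 ⊆ (𝔽₂ × 𝔽₂)^{20} (20 qubits arranged as 5 blocks of 4) be the 𝔽₂-span of the following vectors, written as Pauli operators: the ten block-wise inner stabilizer generators placing ZZZZ or ZZII on one of the 5 blocks and identity elsewhere, together with the four vectors (IZZZ, I, I, I, I), (I, IZZZ, IZZZ, IZZZ, IZZZ), (I, XXXX, XXXX, XXXX, XXXX), and (I, I, I, XXXX, XXXX), where each four-character group denotes one block of 4 qubits and I denotes the identity block IIII. Then dim_{𝔽₂} S_𝒞 = 14, S_𝒞 ⊆ S_𝒞^⊥, and the vector v corresponding to the Pauli operator with a single Z on qubit 3 (i.e., (IIZI, I, I, I, I)) satisfies v ∈ S_𝒞^⊥ ∖ S_𝒞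 and swt(v) = 1. Consequently this generalized concatenated quantum code has parameters [[20,6,1]]₂ (minimum distance exactly 1, not 2). -/
open Finset

/-- ZZZZ on block `b` of 5 blocks of 4 qubits. -/
def gZZZZ (b : ℕ) : Pauli 20 := fun i => if (i : ℕ) / 4 = b then (0, 1) else 0
/-- ZZII on block `b` of 5 blocks of 4 qubits. -/
def gZZII (b : ℕ) : Pauli 20 := fun i => if (i : ℕ) / 4 = b ∧ (i : ℕ) % 4 < 2 then (0, 1) else 0
/-- The Pauli operator (IZZZ, I, I, I, I). -/
def w1 : Pauli 20 := fun i => if 1 ≤ (i : ℕ) ∧ (i : ℕ) ≤ 3 then (0, 1) else 0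
/-- The Pauli operator (I, IZZZ, IZZZ, IZZZ, IZZZ). -/
def w2 : Pauli 20 := fun i => if 4 ≤ (i : ℕ) ∧ (i : ℕ) % 4 ≠ 0 then (0, 1) else 0
/-- The Pauli operator (I, XXXX, XXXX, XXXX, XXXX). -/
def w3 : Pauli 20 := fun i => if 4 ≤ (i : ℕ) then (1, 0) else 0
/-- The Pauli operator (I, I, I, XXXX, XXXX). -/
def w4 : Pauli 20 := fun i => if 12 ≤ (i : ℕ) then (1, 0) else 0

/-- The GCQC stabilizer of Example 2: the ten block-wise inner generators together
with the four replaced outer generators. -/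
def Sex3 : Submodule (ZMod 2) (Pauli 20) :=
  Submodule.span (ZMod 2) ((gZZZZ '' Set.Iio 5) ∪ (gZZII '' Set.Iio 5) ∪ {w1, w2, w3, w4})

/-- The Pauli operator (IIZI, I, I, I, I): a single Z on qubit 3. -/
def vIIZI : Pauli 20 := fun i => if (i : ℕ) = 2 then (0, 1) else 0

/-- The fourteen generators of `Sex3`. -/
def stabGen : Fin 5 ⊕ Fin 5 ⊕ Fin 4 → Pauli 20 :=
  Sum.elim (fun b => gZZZZ b) (Sum.elim (fun b => gZZII b) ![w1, w2, w3, w4])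

/-- A family biorthogonal to `stabGen`: the operators XXXI and IXXI on each block, XXII on each
of the first two blocks, and products of Z on single qubits. -/
def stabDual : Fin 5 ⊕ Fin 5 ⊕ Fin 4 → Pauli 20 :=
  Sum.elim (fun b i => if (i : ℕ) / 4 = b ∧ (i : ℕ) % 4 < 3 then (1, 0) else 0)
    (Sum.elim
      (fun b i => if (i : ℕ) / 4 = b ∧ ((i : ℕ) % 4 = 1 ∨ (i : ℕ) % 4 = 2) then (1, 0) else 0)
      ![fun i => if (i : ℕ) < 2 then (1, 0) else 0,
        fun i => if (i : ℕ) = 4 ∨ (i : ℕ) = 5 then (1, 0) else 0,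
        fun i => if (i : ℕ) = 4 then (0, 1) else 0,
        fun i => if (i : ℕ) = 4 ∨ (i : ℕ) = 12 then (0, 1) else 0])

/-- The Pauli operator (IIXX, I, I, I, I). -/
def vIIXX : Pauli 20 := fun i => if (i : ℕ) = 2 ∨ (i : ℕ) = 3 then (1, 0) else 0

theorem symplF_apply {n : ℕ} (u v : Pauli n) :
    symplF n u v = ∑ i, ((u i).1 * (v i).2 + (v i).1 * (u i).2) := rfl

theorem perp_span_range {M ι : Type*} [AddCommGroup M] [Module (ZMod 2) M]
    (B : LinearMap.BilinForm (ZMod 2) M) (g : ι → M) (v : M) :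
    v ∈ perp B (Submodule.span (ZMod 2) (Set.range g)) ↔ ∀ i, B (g i) v = 0 := by
  refine ⟨fun h i => h _ (Submodule.subset_span ⟨i, rfl⟩), fun h s hs => ?_⟩
  have hle : Submodule.span (ZMod 2) (Set.range g) ≤ LinearMap.ker (B.flip v) :=
    Submodule.span_le.2 (by rintro _ ⟨i, rfl⟩; exact h i)
  exact hle hs

theorem Sex3_eq_span_range : Sex3 = Submodule.span (ZMod 2) (Set.range stabGen) := by
  have himage (f : ℕ → Pauli 20) : f '' Set.Iio 5 = Set.range fun b : Fin 5 => f b := by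
    ext v
    exact ⟨fun ⟨b, hb, h⟩ => ⟨⟨b, hb⟩, h⟩, fun ⟨b, h⟩ => ⟨b, b.2, h⟩⟩
  simp only [Sex3, stabGen, Set.Sum.elim_range, himage, Matrix.range_cons, Matrix.range_empty,
    Set.union_assoc, Set.union_empty, Set.insert_eq]

theorem mem_perp_Sex3 {v : Pauli 20} :
    v ∈ perp (symplF 20) Sex3 ↔ ∀ i, symplF 20 (stabGen i) v = 0 := by
  rw [Sex3_eq_span_range, perp_span_range]

theorem symplF_stabDual_stabGen (i j : Fin 5 ⊕ Fin 5 ⊕ Fin 4) :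
    symplF 20 (stabDual i) (stabGen j) = if i = j then 1 else 0 := by
  rw [symplF_apply]
  revert i j
  decide +kernel

theorem symplF_stabGen_stabGen (i j : Fin 5 ⊕ Fin 5 ⊕ Fin 4) :
    symplF 20 (stabGen i) (stabGen j) = 0 := by
  rw [symplF_apply]
  revert i j
  decide +kernel

theorem symplF_stabGen_vIIZI (i : Fin 5 ⊕ Fin 5 ⊕ Fin 4) :
    symplF 20 (stabGen i) vIIZI = 0 := by
  rw [symplF_apply]
  revert i
  decide +kernel

theorem symplF_stabGen_vIIXX (i : Fin 5 ⊕ Fin 5 ⊕ Fin 4) :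
    symplF 20 (stabGen i) vIIXX = 0 := by
  rw [symplF_apply]
  revert i
  decide +kernel

theorem symplF_vIIZI_vIIXX : symplF 20 vIIZI vIIXX = 1 := by
  rw [symplF_apply]
  decide +kernel

theorem linearIndependent_stabGen : LinearIndependent (ZMod 2) stabGen :=
  LinearIndependent.of_pairwise_dual_eq_zero_one stabGen (fun i => symplF 20 (stabDual i))
    (fun i j hij => by simp [symplF_stabDual_stabGen, hij])
    (fun i => by simp [symplF_stabDual_stabGen])

theorem one_le_wgt {N : ℕ} {M : Type*} [Zero M] [DecidableEq M] {v : Fin N → M} (hv : v ≠ 0) :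
    1 ≤ wgt v := by
  obtain ⟨j, hj⟩ := Function.ne_iff.1 hv
  exact Finset.card_pos.2 ⟨j, by simpa using hj⟩

/-- Example 2: a degenerate outer code forces distance 1; the resulting GCQC has
parameters [[20,6,1]]₂ (not distance 2). -/
theorem example_20_6_1 :
    Module.finrank (ZMod 2) Sex3 = 14
    ∧ Sex3 ≤ perp (symplF 20) Sex3
    ∧ vIIZI ∈ perp (symplF 20) Sex3 ∧ vIIZI ∉ Sex3 ∧ wgt vIIZI = 1
    ∧ (∀ v ∈ perp (symplF 20) Sex3, v ∉ Sex3 → 1 ≤ wgt v) := by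
  refine ⟨?_, ?_, mem_perp_Sex3.2 symplF_stabGen_vIIZI, fun h => ?_, by decide +kernel,
    fun v _ hv => one_le_wgt fun h0 => hv (h0 ▸ Sex3.zero_mem)⟩
  · rw [Sex3_eq_span_range, finrank_span_eq_card linearIndependent_stabGen]
    rfl
  · conv_lhs => rw [Sex3_eq_span_range]
    rw [Submodule.span_le]
    rintro _ ⟨j, rfl⟩
    exact mem_perp_Sex3.2 fun i => symplF_stabGen_stabGen i j
  · have h0 := mem_perp_Sex3.2 symplF_stabGen_vIIXX vIIZI h
    exact one_ne_zero (symplF_vIIZI_vIIXX.symm.trans h0)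
end
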